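/- arXiv:2203.04423 — 2 statements merged into one kernel-verified Lean document; each statement's English description precedes it below -/
import Mathlib

section
/- Let e = R_{e₁,e₋₃} + R_{e₂,e₃} ∈ so(V, β) (a nilpotent element of Jordan type (3²,1)). Then the centralizer of e in so(V, β) equals the ℂ-span of {e, R_{e₁,e₋₁} − R_{e₂,e₋₂} + R_{e₃,e₋₃}, R_{e₂,e₋₃}, R_{e₂,e₀}, R_{e₁,e₀}, R_{e₁,e₃}, R_{e₁,e₂}}; in particular it has dimension 7 over ℂ. -/
noncomputable section

/-- `V = ℂ⁷` with ordered basis `(e₁, e₂, e₃, e₀, e₋₃, e₋₂, e₋₁)`. -/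
abbrev V7 : Type := Fin 7 → ℂ

/-- The Gram matrix of the symmetric bilinear form `β` in the ordered basis
`(e₁, e₂, e₃, e₀, e₋₃, e₋₂, e₋₁)`:  `β(eᵢ, e₋ᵢ) = β(e₋ᵢ, eᵢ) = 1`, `β(e₀,e₀) = 2`,
all other pairs `0`. -/
def Bmat : Matrix (Fin 7) (Fin 7) ℂ :=
  Matrix.of fun i j =>
    if (i : ℕ) + (j : ℕ) = 6 then (if (i : ℕ) = 3 then 2 else 1) else 0

/-- The symmetric bilinear form `β` on `V`. -/
def beta : V7 →ₗ[ℂ] V7 →ₗ[ℂ] ℂ := Matrix.toBilin' Bmat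

/-- `so(V, β) = {x ∈ End(V) : β(xu, w) + β(u, xw) = 0 for all u, w}`. -/
def so7 : Set (Module.End ℂ V7) :=
  {x | ∀ u w : V7, beta (x u) w + beta u (x w) = 0}

/-- `R_{u,w}(v) = β(w,v) • u − β(u,v) • w`. -/
def Rm (u w : V7) : Module.End ℂ V7 :=
  (beta w).smulRight u - (beta u).smulRight w

def e1 : V7 := Pi.single 0 1
def e2 : V7 := Pi.single 1 1
def e3 : V7 := Pi.single 2 1
def e0 : V7 := Pi.single 3 1
def em3 : V7 := Pi.single 4 1
def em2 : V7 := Pi.single 5 1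
def em1 : V7 := Pi.single 6 1

/-- The nilpotent element . -/
def eNil : Module.End ℂ V7 := Rm e1 em3 + Rm e2 e3

/-- The centralizer of  in . -/
def cent : Set (Module.End ℂ V7) := {x | x ∈ so7 ∧ x * eNil = eNil * x}

/-- The claimed spanning set. -/
def spanSet : Set (Module.End ℂ V7) := {eNil, Rm e1 em1 - Rm e2 em2 + Rm e3 em3, Rm e2 em3, Rm e2 e0, Rm e1 e0, Rm e1 e3, Rm e1 e2}

lemma beta_apply (u w : V7) :
    beta u w = u 0 * w 6 + u 1 * w 5 + u 2 * w 4 + 2 * (u 3 * w 3) + u 4 * w 2 + u 5 * w 1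
      + u 6 * w 0 := by
  simp [beta, Matrix.toBilin'_apply, Bmat, Fin.sum_univ_succ, Fin.succ]
  ring

/-- The listed elements spanning the centralizer, as an indexed family. -/
def centFamily : Fin 7 → Module.End ℂ V7 :=
  ![eNil, Rm e1 em1 - Rm e2 em2 + Rm e3 em3, Rm e2 em3, Rm e2 e0, Rm e1 e0, Rm e1 e3, Rm e1 e2]

lemma range_centFamily : Set.range centFamily = spanSet := by
  simp only [centFamily, spanSet, Matrix.range_cons, Matrix.range_empty, Set.union_empty,
    Set.singleton_union]

lemma eNil_apply (v : V7) : eNil v = ![v 2, v 4, -v 5, 0, -v 6, 0, 0] := by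
  ext i
  fin_cases i <;> simp [eNil, Rm, beta_apply, e1, e2, e3, em3]

lemma sum_centFamily_apply (c : Fin 7 → ℂ) (v : V7) :
    (∑ i, c i • centFamily i) v =
      ![c 1 * v 0 + c 0 * v 2 + 2 * c 4 * v 3 + c 5 * v 4 + c 6 * v 5,
        -c 1 * v 1 + c 2 * v 2 + 2 * c 3 * v 3 + c 0 * v 4 - c 6 * v 6,
        c 1 * v 2 - c 0 * v 5 - c 5 * v 6,
        -c 3 * v 5 - c 4 * v 6,
        -c 1 * v 4 - c 2 * v 5 - c 0 * v 6,
        c 1 * v 5,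
        -c 1 * v 6] := by
  ext i
  simp only [Fin.sum_univ_seven, LinearMap.add_apply, LinearMap.smul_apply, Pi.add_apply,
    Pi.smul_apply, smul_eq_mul]
  fin_cases i <;>
    simp [centFamily, eNil_apply, Rm, beta_apply, e1, e2, e3, e0, em3, em2, em1] <;> ring

lemma linearIndependent_centFamily : LinearIndependent ℂ centFamily := by
  rw [Fintype.linearIndependent_iff]
  intro c hc
  have h (j : Fin 7) := congrArg (fun f : Module.End ℂ V7 => f (Pi.single j 1)) hc
  simp only [sum_centFamily_apply] at h
  have h0 := congrFun (h 0) 0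
  have h2 := congrFun (h 2)
  have h3 := congrFun (h 3)
  have h4 := congrFun (h 4) 0
  have h5 := congrFun (h 5) 0
  have h20 := h2 0
  have h21 := h2 1
  have h30 := h3 0
  have h31 := h3 1
  simp at h0 h20 h21 h30 h31 h4 h5
  intro i
  fin_cases i <;> assumption

lemma sum_centFamily_mem_cent (c : Fin 7 → ℂ) : ∑ i, c i • centFamily i ∈ cent := by
  refine ⟨fun u w => ?_, LinearMap.ext fun v => ?_⟩
  · simp only [sum_centFamily_apply, beta_apply]
    simp
    ring
  · simp only [Module.End.mul_apply, sum_centFamily_apply, eNil_apply]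
    ext i
    fin_cases i <;> simp <;> ring

lemma exists_sum_centFamily_eq {x : Module.End ℂ V7} (hx : x ∈ cent) :
    ∃ c : Fin 7 → ℂ, ∑ i, c i • centFamily i = x := by
  obtain ⟨hso, hcomm⟩ := hx
  set M : Fin 7 → Fin 7 → ℂ := fun i j => x (Pi.single j 1) i with hM
  have hxv (v : V7) (i : Fin 7) : x v i = ∑ j, v j * M i j := by
    conv_lhs => rw [pi_eq_sum_univ' v]
    simp [hM, map_sum]
  have hS (i j : Fin 7) := hso (Pi.single i 1) (Pi.single j 1)
  have hC (i j : Fin 7) := congrFun (LinearMap.congr_fun hcomm (Pi.single j 1)) i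
  simp only [Module.End.mul_apply, eNil_apply, beta_apply, hxv, Fin.sum_univ_seven] at hS hC
  refine ⟨![M 0 2, M 0 0, M 1 2, -M 3 5, -M 3 6, M 0 4, M 0 5], LinearMap.ext fun v => ?_⟩
  rw [sum_centFamily_apply]
  simp [Fin.forall_fin_succ, Fin.succ, Pi.single_apply] at hS hC
  ext i
  rw [hxv, Fin.sum_univ_seven]
  fin_cases i <;> simp <;> grind

theorem statement3 :
    cent = ↑(Submodule.span ℂ spanSet) ∧
      Module.finrank ℂ ↥(Submodule.span ℂ spanSet) = 7 := by
  rw [← range_centFamily]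
  refine ⟨Set.ext fun x => ?_, ?_⟩
  · rw [SetLike.mem_coe, Submodule.mem_span_range_iff_exists_fun]
    refine ⟨exists_sum_centFamily_eq, ?_⟩
    rintro ⟨c, rfl⟩
    exact sum_centFamily_mem_cent c
  · simpa using finrank_span_eq_card linearIndependent_centFamily
end
end

section
/- Let e = R_{e₁,e₋₃} + R_{e₂,e₃} and h = 2·R_{e₁,e₋₁} + 2·R_{e₂,e₋₂}, both elements of so(V, β). Then there exists f ∈ so(V, β) such that ⁅h, e⁆ = 2·e, ⁅h, f⁆ = −2·f, and ⁅e, f⁆ = h (so {e, h, f} is an sl(2)-triple in so(V, β)). -/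
noncomputable section

/-- The semisimple element. -/
def hSem : Module.End ℂ V7 := (2:ℂ) • Rm e1 em1 + (2:ℂ) • Rm e2 em2

lemma beta_comm (u w : V7) : beta u w = beta w u := by
  have hsymm : Bmat.transpose = Bmat := by
    ext i j
    fin_cases i <;> fin_cases j <;> simp [Bmat]
  simp only [beta, Matrix.toBilin'_apply']
  rw [Matrix.dotProduct_mulVec, ← Matrix.mulVec_transpose, hsymm, dotProduct_comm]

lemma beta_single (i j : Fin 7) :
    beta (Pi.single i 1) (Pi.single j 1) =
      if (i : ℕ) + (j : ℕ) = 6 then (if (i : ℕ) = 3 then 2 else 1) else 0 := by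
  simp [beta, Matrix.toBilin'_single, Bmat]

lemma Rm_apply (u w v : V7) : Rm u w v = beta w v • u - beta u v • w := rfl

lemma Rm_mem_so7 (u w : V7) : Rm u w ∈ so7 := by
  intro a b
  simp only [Rm_apply, map_sub, map_smul, LinearMap.sub_apply, LinearMap.smul_apply, smul_eq_mul]
  rw [beta_comm a u, beta_comm a w]
  ring

lemma so7_add_mem {x y : Module.End ℂ V7} (hx : x ∈ so7) (hy : y ∈ so7) : x + y ∈ so7 := by
  intro u w
  simp only [LinearMap.add_apply, map_add]
  linear_combination hx u w + hy u w

lemma so7_smul_mem (c : ℂ) {x : Module.End ℂ V7} (hx : x ∈ so7) : c • x ∈ so7 := by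
  intro u w
  simp only [LinearMap.smul_apply, map_smul, smul_eq_mul]
  linear_combination c * hx u w

lemma end_lie_add (x y z : Module.End ℂ V7) : ⁅x, y + z⁆ = ⁅x, y⁆ + ⁅x, z⁆ := by
  refine LinearMap.ext fun v => ?_
  simp only [Ring.lie_def, LinearMap.sub_apply, LinearMap.add_apply, Module.End.mul_apply, map_add]
  abel

lemma end_lie_smul (c : ℂ) (x y : Module.End ℂ V7) : ⁅x, c • y⁆ = c • ⁅x, y⁆ := by
  refine LinearMap.ext fun v => ?_
  simp only [Ring.lie_def, LinearMap.sub_apply, LinearMap.smul_apply, Module.End.mul_apply,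
    map_smul, smul_sub]

/-- An element of `so(V, β)` acts on the operators `R_{a,b}` as a derivation. -/
lemma lie_Rm {x : Module.End ℂ V7} (hx : x ∈ so7) (a b : V7) :
    ⁅x, Rm a b⁆ = Rm (x a) b + Rm a (x b) := by
  refine LinearMap.ext fun v => ?_
  have ha : beta (x a) v = -beta a (x v) := eq_neg_of_add_eq_zero_left (hx a v)
  have hb : beta (x b) v = -beta b (x v) := eq_neg_of_add_eq_zero_left (hx b v)
  simp only [Ring.lie_def, LinearMap.sub_apply, LinearMap.add_apply, Module.End.mul_apply,
    Rm_apply, map_sub, map_smul, ha, hb]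
  module

lemma Rm_zero_left (w : V7) : Rm 0 w = 0 := by simp [Rm]

lemma Rm_zero_right (u : V7) : Rm u 0 = 0 := by simp [Rm]

lemma Rm_smul_left (c : ℂ) (u w : V7) : Rm (c • u) w = c • Rm u w := by
  refine LinearMap.ext fun v => ?_
  simp only [Rm_apply, LinearMap.smul_apply, map_smul, smul_eq_mul]
  module

lemma Rm_smul_right (c : ℂ) (u w : V7) : Rm u (c • w) = c • Rm u w := by
  refine LinearMap.ext fun v => ?_
  simp only [Rm_apply, LinearMap.smul_apply, map_smul, smul_eq_mul]
  module

lemma Rm_neg_right (u w : V7) : Rm u (-w) = -Rm u w := by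
  rw [← neg_one_smul ℂ w, Rm_smul_right]
  module

lemma Rm_swap (u w : V7) : Rm u w = -Rm w u := by simp [Rm]

lemma eNil_mem_so7 : eNil ∈ so7 := so7_add_mem (Rm_mem_so7 _ _) (Rm_mem_so7 _ _)

lemma hSem_mem_so7 : hSem ∈ so7 :=
  so7_add_mem (so7_smul_mem _ (Rm_mem_so7 _ _)) (so7_smul_mem _ (Rm_mem_so7 _ _))

/-- The lowering operator of the `sl(2)`-triple of `eNil` and `hSem`. -/
def fNil : Module.End ℂ V7 := (2 : ℂ) • Rm e3 em1 + (2 : ℂ) • Rm em3 em2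

lemma fNil_mem_so7 : fNil ∈ so7 :=
  so7_add_mem (so7_smul_mem _ (Rm_mem_so7 _ _)) (so7_smul_mem _ (Rm_mem_so7 _ _))

lemma hSem_e1 : hSem e1 = (2 : ℂ) • e1 := by
  simp [hSem, Rm_apply, e1, e2, em1, em2, beta_single]

lemma hSem_e2 : hSem e2 = (2 : ℂ) • e2 := by
  simp [hSem, Rm_apply, e1, e2, em1, em2, beta_single]

lemma hSem_e3 : hSem e3 = 0 := by
  simp [hSem, Rm_apply, e1, e2, e3, em1, em2, beta_single]

lemma hSem_em3 : hSem em3 = 0 := by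
  simp [hSem, Rm_apply, e1, e2, em3, em1, em2, beta_single]

lemma hSem_em2 : hSem em2 = (-2 : ℂ) • em2 := by
  simp [hSem, Rm_apply, e1, e2, em1, em2, beta_single]

lemma hSem_em1 : hSem em1 = (-2 : ℂ) • em1 := by
  simp [hSem, Rm_apply, e1, e2, em1, em2, beta_single]

lemma eNil_e3 : eNil e3 = e1 := by
  simp [eNil, Rm_apply, e1, e2, e3, em3, beta_single]

lemma eNil_em3 : eNil em3 = e2 := by
  simp [eNil, Rm_apply, e1, e2, e3, em3, beta_single]

lemma eNil_em2 : eNil em2 = -e3 := by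
  simp [eNil, Rm_apply, e1, e2, e3, em3, em2, beta_single]

lemma eNil_em1 : eNil em1 = -em3 := by
  simp [eNil, Rm_apply, e1, e2, e3, em3, em1, beta_single]

theorem statement9 :
    ∃ f ∈ so7, ⁅hSem, eNil⁆ = (2 : ℂ) • eNil ∧ ⁅hSem, f⁆ = (-2 : ℂ) • f ∧ ⁅eNil, f⁆ = hSem := by
  refine ⟨fNil, fNil_mem_so7, ?_, ?_, ?_⟩
  · simp only [eNil, end_lie_add, lie_Rm hSem_mem_so7, hSem_e1, hSem_e2, hSem_e3, hSem_em3,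
      Rm_smul_left, Rm_zero_right]
    module
  · simp only [fNil, end_lie_add, end_lie_smul, lie_Rm hSem_mem_so7, hSem_e3, hSem_em3, hSem_em1,
      hSem_em2, Rm_smul_right, Rm_zero_left]
    module
  · simp only [fNil, hSem, end_lie_add, end_lie_smul, lie_Rm eNil_mem_so7, eNil_e3, eNil_em3, eNil_em1,
      eNil_em2, Rm_neg_right, Rm_swap em3 e3]
    module
end
end
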